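/- There exists a constant C₀ ≥ 20 such that for every C ≥ C₀: |E_{(X,Y) ~ D}[φ_{i≠j}(X,Y)] − E_{(X,Y') ~ G'}[φ_{i≠j}(X,Y')]| ≤ 16·N^{−2}, where (X,Y) denotes the first N and last N coordinates of a sample from D. -/

import Mathlib

open MeasureTheory ProbabilityTheory Finset

noncomputable section

/-- Bit strings of length `n`; there are `N = 2^n` of them. -/
abbrev BV (n : ℕ) := Fin n → Bool

/-- Inner product (mod nothing, just the count) of two bit strings. -/
def bip {n : ℕ} (x y : BV n) : ℕ := (Finset.univ.filter fun i => x i && y i).card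

/-- The `N × N` normalized Walsh-Hadamard matrix, `H_{x,y} = (-1)^{⟨x,y⟩} / √N`. -/
def Had (n : ℕ) : Matrix (BV n) (BV n) ℝ :=
  Matrix.of fun x y => (-1 : ℝ) ^ bip x y / Real.sqrt (2 ^ n)

/-- `ε = 1 / (C ln N)` with `N = 2^n`. -/
def eps (C : ℝ) (n : ℕ) : ℝ := 1 / (C * Real.log (2 ^ n))

/-- The Gaussian vector `X` with i.i.d. `N(0, ε)` coordinates. -/
def gaussVec (C : ℝ) (n : ℕ) : Measure (BV n → ℝ) :=
  Measure.pi fun _ => gaussianReal 0 (eps C n).toNNReal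

/-- The distribution `G'` of `Z = (X, Y∘Y - ε·𝟙)` with `Y = H·X`, packed as a
function on `BV n ⊕ BV n` (first `N` coordinates are `X`, last `N` are `Y∘Y - ε`). -/
def Gmeas' (C : ℝ) (n : ℕ) : Measure (BV n ⊕ BV n → ℝ) :=
  (gaussVec C n).map fun X => Sum.elim X fun i => ((Had n).mulVec X i) ^ 2 - eps C n

/-- Truncation to `[-1, 1]`. -/
def trnc (a : ℝ) : ℝ := min 1 (max (-1) a)

/-- Randomized rounding of `a` to `±1`: output `1` with probability `(1 + trnc a)/2`
and `-1` with probability `(1 - trnc a)/2`. -/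
def roundM (a : ℝ) : Measure ℝ :=
  ((1 + trnc a) / 2).toNNReal • Measure.dirac 1 +
    ((1 - trnc a) / 2).toNNReal • Measure.dirac (-1)

/-- The distribution `D` on `{±1}^{2N}`: sample `z ~ G'` and round each coordinate
independently. -/
def Dmeas (C : ℝ) (n : ℕ) : Measure (BV n ⊕ BV n → ℝ) :=
  (Gmeas' C n).bind fun z => Measure.pi fun i => roundM (z i)

/-- `F : ℝ^ι → ℝ` is multilinear if `F z = Σ_S F̂(S) ∏_{i ∈ S} z_i`. -/
def IsMultilinear {ι : Type*} [Fintype ι] [DecidableEq ι] (F : (ι → ℝ) → ℝ) : Prop :=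
  ∃ c : Finset ι → ℝ, ∀ z, F z = ∑ S : Finset ι, c S * ∏ i ∈ S, z i

/-- The Fourier coefficient `F̂(S)` of `F` (over the hypercube `{±1}^ι`); for a
multilinear `F` these are precisely its multilinear coefficients. -/
def mlCoeff {ι : Type*} [Fintype ι] [DecidableEq ι] (F : (ι → ℝ) → ℝ) (S : Finset ι) : ℝ :=
  (∑ z : ι → Bool, F (fun i => if z i then 1 else -1) * ∏ i ∈ S, (if z i then (1 : ℝ) else -1)) /
    2 ^ Fintype.card ι

/-- `L_{1,2}(F) = Σ_{|S| = 2} |F̂(S)|`. -/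
def L12 {ι : Type*} [Fintype ι] [DecidableEq ι] (F : (ι → ℝ) → ℝ) : ℝ :=
  ∑ S ∈ Finset.univ.filter (fun S : Finset ι => S.card = 2), |mlCoeff F S|

/-- The restriction `F_ρ` of `F` under `ρ = (S, w)`: coordinates outside `S` are
fixed to the values of `w`. -/
def restrictML {ι : Type*} [DecidableEq ι] (F : (ι → ℝ) → ℝ) (S : Finset ι)
    (w : ι → ℝ) : (ι → ℝ) → ℝ :=
  fun y => F fun i => if i ∈ S then y i else w i

/-- `φ(X, Y) = (1/N) Σ_i (Σ_j H_{ij} X_j)² Y_i`. -/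
def phi (n : ℕ) (X Y : BV n → ℝ) : ℝ :=
  (∑ i, ((Had n).mulVec X i) ^ 2 * Y i) / 2 ^ n

/-- The multilinear part `φ_{i≠j}(X, Y) = (1/N) Σ_i Σ_{j ≠ k} H_{ij} H_{ik} X_j X_k Y_i`. -/
def phiOff (n : ℕ) (X Y : BV n → ℝ) : ℝ :=
  (∑ i, ∑ j, ∑ k ∈ Finset.univ \ {j}, Had n i j * Had n i k * X j * X k * Y i) / 2 ^ n

/-- The Fourier coefficient `f̂(x) = 2^{-n} Σ_y f(y) (-1)^{⟨x,y⟩}` of `f : {0,1}^n → {±1}`. -/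
def hatF (n : ℕ) (f : BV n → ℝ) (x : BV n) : ℝ :=
  (∑ y, f y * (-1 : ℝ) ^ bip x y) / 2 ^ n

lemma trnc_of_abs_le {a : ℝ} (h : |a| ≤ 1) : trnc a = a := by
  rw [abs_le] at h
  rw [trnc, max_eq_right h.1, min_eq_right h.2]

lemma neg_one_le_trnc (a : ℝ) : -1 ≤ trnc a := le_min (by norm_num) (le_max_left _ _)

lemma trnc_le_one (a : ℝ) : trnc a ≤ 1 := min_le_left _ _

lemma abs_trnc_le_one (a : ℝ) : |trnc a| ≤ 1 := abs_le.2 ⟨neg_one_le_trnc a, trnc_le_one a⟩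

lemma exists_trnc_eq_mul (a : ℝ) : ∃ t : ℝ, 0 ≤ t ∧ t ≤ 1 ∧ trnc a = t * a := by
  rcases le_or_gt |a| 1 with h | h
  · exact ⟨1, zero_le_one, le_rfl, by rw [trnc_of_abs_le h, one_mul]⟩
  · rcases lt_abs.1 h with h | h
    · refine ⟨a⁻¹, by positivity, inv_le_one_of_one_le₀ h.le, ?_⟩
      rw [inv_mul_cancel₀ (by positivity), trnc, max_eq_right (by linarith), min_eq_left h.le]
    · have h' : a < 0 := by linarith
      refine ⟨(-a)⁻¹, inv_nonneg.2 (by linarith), inv_le_one_of_one_le₀ h.le, ?_⟩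
      rw [inv_neg, neg_mul, inv_mul_cancel₀ h'.ne, trnc, max_eq_left (by linarith),
        min_eq_right (by norm_num)]

@[fun_prop]
lemma measurable_trnc : Measurable trnc := by
  unfold trnc
  fun_prop

/-- Truncating the factors of a product scales it by a number in `[0, 1]`. -/
lemma abs_trnc_mul_sub_le (a b c : ℝ) :
    |trnc a * trnc b * trnc c - a * b * c| ≤ |a| * |b| * |c| := by
  obtain ⟨r, hr0, hr1, hr⟩ := exists_trnc_eq_mul a
  obtain ⟨s, hs0, hs1, hs⟩ := exists_trnc_eq_mul b
  obtain ⟨t, ht0, ht1, ht⟩ := exists_trnc_eq_mul c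
  have h0 : 0 ≤ r * s * t := by positivity
  have h1 : r * s * t ≤ 1 := mul_le_one₀ (mul_le_one₀ hr1 hs0 hs1) ht0 ht1
  have : trnc a * trnc b * trnc c - a * b * c = (r * s * t - 1) * (a * b * c) := by
    rw [hr, hs, ht]; ring
  rw [this, abs_mul, abs_mul, abs_mul]
  refine mul_le_of_le_one_left (by positivity) ?_
  rw [abs_le]
  constructor <;> linarith

lemma pow_four_le_cosh {s M v : ℝ} (hs : 4 ≤ s) (hM : 1 ≤ M) (hv : |v| = M) :
    M ^ 4 ≤ 2 * Real.exp (-s) * Real.cosh (s * v) := by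
  have h1 : M ≤ Real.exp (M - 1) := by linarith [Real.add_one_le_exp (M - 1)]
  calc M ^ 4 ≤ Real.exp (M - 1) ^ 4 := by gcongr
    _ = Real.exp (4 * (M - 1)) := by rw [← Real.exp_nat_mul]; norm_num
    _ ≤ Real.exp (s * (M - 1)) := by gcongr
    _ = Real.exp (-s) * Real.exp (s * M) := by rw [← Real.exp_add]; ring_nf
    _ ≤ Real.exp (-s) * (2 * Real.cosh (s * M)) := by
        gcongr
        rw [Real.cosh_eq]
        linarith [Real.exp_pos (-(s * M))]
    _ = 2 * Real.exp (-s) * Real.cosh (s * v) := by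
        rw [← Real.cosh_abs (s * v), abs_mul, abs_of_nonneg (by linarith : 0 ≤ s), hv]; ring

lemma abs_trnc_mul_sub_le_cosh {e s : ℝ} (he0 : 0 ≤ e) (he1 : e ≤ 1) (hs : 4 ≤ s) (a b y : ℝ) :
    |trnc a * trnc b * trnc (y ^ 2 - e) - a * b * (y ^ 2 - e)| ≤
      2 * Real.exp (-s) * (Real.cosh (s * a) + Real.cosh (s * b) + Real.cosh (s * y)) := by
  have hpos (v : ℝ) : 0 ≤ 2 * Real.exp (-s) * Real.cosh (s * v) := by positivity
  have ha := hpos a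
  have hb := hpos b
  have hy := hpos y
  set M := max (max |a| |b|) |y| with hM
  have haM : |a| ≤ M := (le_max_left _ _).trans (le_max_left _ _)
  have hbM : |b| ≤ M := (le_max_right _ _).trans (le_max_left _ _)
  have hyM : |y| ≤ M := le_max_right _ _
  have hM0 : 0 ≤ M := (abs_nonneg a).trans haM
  have hyy : y ^ 2 ≤ M ^ 2 := by rw [← sq_abs y]; gcongr
  rcases le_or_gt M 1 with h | h
  · have hM1 : M ^ 2 ≤ 1 := pow_le_one₀ hM0 h
    rw [trnc_of_abs_le (haM.trans h), trnc_of_abs_le (hbM.trans h), trnc_of_abs_le, sub_self,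
      abs_zero]
    · positivity
    · rw [abs_le]
      constructor <;> nlinarith [sq_nonneg y]
  · have hc : |y ^ 2 - e| ≤ M ^ 2 := by
      rw [abs_le]
      constructor <;> nlinarith [sq_nonneg y]
    have hmain : M ^ 4 ≤
        2 * Real.exp (-s) * (Real.cosh (s * a) + Real.cosh (s * b) + Real.cosh (s * y)) := by
      rw [mul_add, mul_add]
      have : |a| = M ∨ |b| = M ∨ |y| = M := by
        rcases max_choice (max |a| |b|) |y| with h1 | h1
        · rcases max_choice |a| |b| with h2 | h2
          · exact Or.inl (by rw [hM, h1, h2])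
          · exact Or.inr (Or.inl (by rw [hM, h1, h2]))
        · exact Or.inr (Or.inr (by rw [hM, h1]))
      rcases this with h1 | h1 | h1
      all_goals linarith [pow_four_le_cosh hs h.le h1]
    calc _ ≤ |a| * |b| * |y ^ 2 - e| := abs_trnc_mul_sub_le _ _ _
      _ ≤ M * M * M ^ 2 := by gcongr
      _ = M ^ 4 := by ring
      _ ≤ _ := hmain

instance isProbabilityMeasure_roundM (a : ℝ) : IsProbabilityMeasure (roundM a) := by
  have h1 : 0 ≤ (1 + trnc a) / 2 := by linarith [neg_one_le_trnc a]
  have h2 : 0 ≤ (1 - trnc a) / 2 := by linarith [trnc_le_one a]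
  refine ⟨?_⟩
  simp only [roundM, Measure.coe_add, Measure.coe_nnreal_smul_apply, Pi.add_apply, measure_univ,
    mul_one]
  rw [← ENNReal.coe_add, ← Real.toNNReal_add h1 h2]
  ring_nf
  simp

lemma ae_abs_eq_one_roundM (a : ℝ) : ∀ᵐ x ∂roundM a, |x| = 1 := by
  rw [roundM, ae_add_measure_iff]
  constructor <;> refine Measure.ae_smul_measure ?_ _ <;> rw [ae_dirac_eq] <;> simp

lemma integrable_id_roundM (a : ℝ) : Integrable (fun x : ℝ => x) (roundM a) :=
  Integrable.of_bound (by fun_prop) 1 ((ae_abs_eq_one_roundM a).mono fun _ h => h.le)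

lemma integral_id_roundM (a : ℝ) : ∫ x, x ∂roundM a = trnc a := by
  have h1 : 0 ≤ (1 + trnc a) / 2 := by linarith [neg_one_le_trnc a]
  have h2 : 0 ≤ (1 - trnc a) / 2 := by linarith [trnc_le_one a]
  have h := integrable_id_roundM a
  rw [roundM] at h ⊢
  rw [integral_add_measure (h.mono_measure (Measure.le_add_right le_rfl))
    (h.mono_measure (Measure.le_add_left le_rfl)), integral_smul_nnreal_measure,
    integral_smul_nnreal_measure, integral_dirac, integral_dirac, NNReal.smul_def, NNReal.smul_def,
    Real.coe_toNNReal _ h1, Real.coe_toNNReal _ h2]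
  simp only [smul_eq_mul]
  ring

@[fun_prop]
lemma measurable_roundM : Measurable roundM := by
  refine Measure.measurable_of_measurable_coe _ fun s _ => ?_
  simp only [roundM, Measure.coe_add, Measure.coe_nnreal_smul_apply, Pi.add_apply]
  fun_prop

section Rounding

variable {ι : Type*} [Fintype ι]

lemma measurable_pi_roundM :
    Measurable fun z : ι → ℝ => Measure.pi fun i => roundM (z i) := by
  refine .measure_of_isPiSystem_of_isProbabilityMeasure generateFrom_pi.symm isPiSystem_pi ?_
  rintro _ ⟨s, hs, rfl⟩
  simp only [Measure.pi_pi]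
  refine Finset.measurable_prod _ fun i _ => ?_
  exact (Measure.measurable_coe (show MeasurableSet (s i) from hs i (Set.mem_univ i))).comp
    (measurable_roundM.comp (measurable_pi_apply i))

/-- Independent rounding of every coordinate, as a Markov kernel. -/
def roundKernel (ι : Type*) [Fintype ι] : Kernel (ι → ℝ) (ι → ℝ) :=
  ⟨fun z => Measure.pi fun i => roundM (z i), measurable_pi_roundM⟩

lemma roundKernel_apply (z : ι → ℝ) : roundKernel ι z = Measure.pi fun i => roundM (z i) := rfl

instance : IsMarkovKernel (roundKernel ι) :=
  ⟨fun z => by rw [roundKernel_apply]; infer_instance⟩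

lemma integral_prod_roundKernel (S : Finset ι) (z : ι → ℝ) :
    ∫ x, ∏ i ∈ S, x i ∂roundKernel ι z = ∏ i ∈ S, trnc (z i) := by
  classical
  have h (x : ι → ℝ) : ∏ i ∈ S, x i = ∏ i, if i ∈ S then x i else 1 := by simp
  rw [roundKernel_apply, h fun i => trnc (z i)]
  simp_rw [h]
  rw [integral_fintype_prod_eq_prod (f := fun i (t : ℝ) => if i ∈ S then t else 1)]
  refine Finset.prod_congr rfl fun i _ => ?_
  split_ifs <;> simp [integral_id_roundM]

lemma ae_abs_prod_roundKernel (S : Finset ι) (z : ι → ℝ) :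
    ∀ᵐ x ∂roundKernel ι z, |∏ i ∈ S, x i| = 1 := by
  have h : ∀ᵐ x ∂roundKernel ι z, ∀ i, |x i| = 1 := by
    rw [roundKernel_apply, ae_all_iff]
    intro i
    exact (Measure.tendsto_eval_ae_ae (μ := fun i => roundM (z i))).eventually
      (ae_abs_eq_one_roundM (z i))
  filter_upwards [h] with x hx
  simp [Finset.abs_prod, hx]

variable (μ : Measure (ι → ℝ)) [IsProbabilityMeasure μ]

lemma integrable_prod_bind_roundKernel (S : Finset ι) :
    Integrable (fun x : ι → ℝ => ∏ i ∈ S, x i) (μ.bind (roundKernel ι)) := by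
  refine Integrable.of_bound (by fun_prop) 1 (Measure.ae_comp_of_ae_ae ?_ ?_)
  · exact measurableSet_le (by fun_prop) measurable_const
  · exact .of_forall fun z => (ae_abs_prod_roundKernel S z).mono fun _ h => h.le

lemma integral_prod_bind_roundKernel (S : Finset ι) :
    ∫ x, ∏ i ∈ S, x i ∂μ.bind (roundKernel ι) = ∫ z, ∏ i ∈ S, trnc (z i) ∂μ := by
  have h := integrable_prod_bind_roundKernel μ S
  rw [Measure.comp_eq_comp_const_apply] at h ⊢
  rw [Kernel.integral_comp h]
  simp [integral_prod_roundKernel]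

end Rounding

section GaussianMoments

variable {ι : Type*} [Fintype ι] (v : NNReal) (c : ι → ℝ)

lemma integrable_exp_sum_gaussianReal :
    Integrable (fun x : ι → ℝ => Real.exp (∑ j, c j * x j))
      (Measure.pi fun _ => gaussianReal 0 v) := by
  simp_rw [Real.exp_sum]
  exact Integrable.fintype_prod (f := fun j t => Real.exp (c j * t))
    fun j => integrable_exp_mul_gaussianReal (c j)

lemma integral_exp_sum_gaussianReal :
    ∫ x : ι → ℝ, Real.exp (∑ j, c j * x j) ∂(Measure.pi fun _ => gaussianReal 0 v) =
      Real.exp (v * (∑ j, c j ^ 2) / 2) := by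
  simp_rw [Real.exp_sum]
  rw [integral_fintype_prod_eq_prod (f := fun j (t : ℝ) => Real.exp (c j * t)), Finset.mul_sum,
    Finset.sum_div, Real.exp_sum]
  refine Finset.prod_congr rfl fun j _ => ?_
  have := congrFun (mgf_fun_id_gaussianReal (μ := 0) (v := v)) (c j)
  simpa [mgf] using this

lemma cosh_mul_sum (s : ℝ) (x : ι → ℝ) :
    Real.cosh (s * ∑ j, c j * x j) =
      (Real.exp (∑ j, s * c j * x j) + Real.exp (∑ j, -s * c j * x j)) / 2 := by
  rw [Real.cosh_eq, ← neg_mul, Finset.mul_sum, Finset.mul_sum]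
  simp only [mul_assoc]

lemma integrable_cosh_sum_gaussianReal (s : ℝ) :
    Integrable (fun x : ι → ℝ => Real.cosh (s * ∑ j, c j * x j))
      (Measure.pi fun _ => gaussianReal 0 v) := by
  simp_rw [cosh_mul_sum]
  exact ((integrable_exp_sum_gaussianReal v _).add
    (integrable_exp_sum_gaussianReal v _)).div_const 2

lemma integral_cosh_sum_gaussianReal (s : ℝ) (hc : ∑ j, c j ^ 2 = 1) :
    ∫ x : ι → ℝ, Real.cosh (s * ∑ j, c j * x j) ∂(Measure.pi fun _ => gaussianReal 0 v) =
      Real.exp (v * s ^ 2 / 2) := by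
  simp_rw [cosh_mul_sum]
  rw [integral_div, integral_add (integrable_exp_sum_gaussianReal v fun j => s * c j)
    (integrable_exp_sum_gaussianReal v fun j => -s * c j),
    integral_exp_sum_gaussianReal v fun j => s * c j,
    integral_exp_sum_gaussianReal v fun j => -s * c j]
  simp only [mul_pow, ← Finset.mul_sum, hc, mul_one, neg_sq]
  ring

end GaussianMoments

lemma abs_Had (n : ℕ) (i j : BV n) : |Had n i j| = 1 / Real.sqrt (2 ^ n) := by
  simp [Had, abs_div, abs_of_nonneg (Real.sqrt_nonneg _)]

lemma sum_Had_sq (n : ℕ) (i : BV n) : ∑ j, Had n i j ^ 2 = 1 := by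
  have h (j : BV n) : Had n i j ^ 2 = 1 / 2 ^ n := by
    rw [← sq_abs, abs_Had, div_pow, Real.sq_sqrt (by positivity), one_pow]
  simp [h]

lemma card_BV (n : ℕ) : (Fintype.card (BV n) : ℝ) = 2 ^ n := by simp

/-- The map taking the Gaussian vector `X` to `(X, Y∘Y - e·𝟙)`, where `Y = H·X`. -/
def gaussPair (e : ℝ) (n : ℕ) (X : BV n → ℝ) : BV n ⊕ BV n → ℝ :=
  Sum.elim X fun i => ((Had n).mulVec X i) ^ 2 - e

lemma measurable_gaussPair (e : ℝ) (n : ℕ) : Measurable (gaussPair e n) := by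
  refine measurable_pi_iff.2 fun l => ?_
  cases l <;> simp only [gaussPair, Sum.elim_inl, Sum.elim_inr, Matrix.mulVec, dotProduct] <;>
    fun_prop

instance (C : ℝ) (n : ℕ) : IsProbabilityMeasure (gaussVec C n) := by
  unfold gaussVec; infer_instance

lemma Gmeas'_eq (C : ℝ) (n : ℕ) :
    Gmeas' C n = (gaussVec C n).map (gaussPair (eps C n) n) := rfl

instance (C : ℝ) (n : ℕ) : IsProbabilityMeasure (Gmeas' C n) :=
  Measure.isProbabilityMeasure_map (measurable_gaussPair _ n).aemeasurable

lemma Dmeas_eq (C : ℝ) (n : ℕ) : Dmeas C n = (Gmeas' C n).bind (roundKernel (BV n ⊕ BV n)) := rfl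

section Monomials

variable {n : ℕ} (C : ℝ) (i : BV n) {j k : BV n}

lemma prod_monomial (hjk : j ≠ k) (z : BV n ⊕ BV n → ℝ) :
    ∏ l ∈ {Sum.inl j, Sum.inl k, Sum.inr i}, z l =
      z (Sum.inl j) * z (Sum.inl k) * z (Sum.inr i) := by
  rw [Finset.prod_insert (by simpa using hjk), Finset.prod_insert (by simp), Finset.prod_singleton,
    mul_assoc]

lemma integrable_monomial_Dmeas (hjk : j ≠ k) :
    Integrable (fun z => z (Sum.inl j) * z (Sum.inl k) * z (Sum.inr i)) (Dmeas C n) := by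
  simp_rw [← prod_monomial i hjk]
  exact integrable_prod_bind_roundKernel (Gmeas' C n) _

lemma integral_monomial_Dmeas (hjk : j ≠ k) :
    ∫ z, z (Sum.inl j) * z (Sum.inl k) * z (Sum.inr i) ∂Dmeas C n =
      ∫ z, trnc (z (Sum.inl j)) * trnc (z (Sum.inl k)) * trnc (z (Sum.inr i)) ∂Gmeas' C n := by
  simp_rw [← prod_monomial i hjk, fun z : BV n ⊕ BV n → ℝ =>
    (prod_monomial i hjk fun l => trnc (z l)).symm]
  exact integral_prod_bind_roundKernel (Gmeas' C n) _

variable {C} (j k)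

lemma integrable_trnc_monomial_Gmeas' :
    Integrable (fun z => trnc (z (Sum.inl j)) * trnc (z (Sum.inl k)) * trnc (z (Sum.inr i)))
      (Gmeas' C n) := by
  refine Integrable.of_bound (Measurable.aestronglyMeasurable (by fun_prop)) 1
    (.of_forall fun z => ?_)
  rw [Real.norm_eq_abs, abs_mul, abs_mul]
  exact mul_le_one₀ (mul_le_one₀ (abs_trnc_le_one _) (abs_nonneg _) (abs_trnc_le_one _))
    (abs_nonneg _) (abs_trnc_le_one _)

/-- The rounding error of a monomial is integrable, and its mean is exponentially small. -/
lemma trnc_monomial_error (he0 : 0 < eps C n) (he1 : 4 * eps C n ≤ 1) :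
    Integrable (fun z => trnc (z (Sum.inl j)) * trnc (z (Sum.inl k)) * trnc (z (Sum.inr i)) -
      z (Sum.inl j) * z (Sum.inl k) * z (Sum.inr i)) (Gmeas' C n) ∧
    |∫ z, (trnc (z (Sum.inl j)) * trnc (z (Sum.inl k)) * trnc (z (Sum.inr i)) -
      z (Sum.inl j) * z (Sum.inl k) * z (Sum.inr i)) ∂Gmeas' C n| ≤
      6 * Real.exp (-(1 / (2 * eps C n))) := by
  set e := eps C n with he
  set s := 1 / e with hs
  have hs4 : 4 ≤ s := by rw [hs, le_div_iff₀ he0]; exact he1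
  let B : (BV n → ℝ) → ℝ := fun X => 2 * Real.exp (-s) * (Real.cosh (s * X j) +
    Real.cosh (s * X k) + Real.cosh (s * (Had n).mulVec X i))
  have hsingle (l : BV n) (X : BV n → ℝ) : X l = ∑ m, (Pi.single l 1 : BV n → ℝ) m * X m := by
    simp [Pi.single_apply]
  have hsq (l : BV n) : ∑ m, (Pi.single l 1 : BV n → ℝ) m ^ 2 = 1 := by
    simp [Pi.single_apply]
  have hv : (((eps C n).toNNReal : NNReal) : ℝ) * s ^ 2 / 2 = s / 2 := by
    rw [Real.coe_toNNReal _ he0.le, hs]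
    field_simp
  have hint (l : BV n) : Integrable (fun X => Real.cosh (s * X l)) (gaussVec C n) := by
    simp_rw [hsingle l]
    exact integrable_cosh_sum_gaussianReal _ _ s
  have hval (l : BV n) : ∫ X, Real.cosh (s * X l) ∂gaussVec C n = Real.exp (s / 2) := by
    simp_rw [hsingle l]
    rw [gaussVec, integral_cosh_sum_gaussianReal _ _ s (hsq l), hv]
  have hintH : Integrable (fun X => Real.cosh (s * (Had n).mulVec X i)) (gaussVec C n) :=
    integrable_cosh_sum_gaussianReal _ (Had n i) s
  have hvalH : ∫ X, Real.cosh (s * (Had n).mulVec X i) ∂gaussVec C n = Real.exp (s / 2) := by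
    rw [← hv]
    exact integral_cosh_sum_gaussianReal _ (Had n i) s (sum_Had_sq n i)
  have hB : Integrable B (gaussVec C n) :=
    (((hint j).add (hint k)).add hintH).const_mul _
  have hBval : ∫ X, B X ∂gaussVec C n = 6 * Real.exp (-(1 / (2 * e))) := by
    have hadd := integral_add (hint j) (hint k)
    have hadd' := integral_add ((hint j).add (hint k)) hintH
    simp only [Pi.add_apply] at hadd'
    rw [integral_const_mul, hadd', hadd, hval, hval, hvalH]
    have : -(1 / (2 * e)) = -s + s / 2 := by rw [hs]; field_simp; ring
    rw [this, Real.exp_add]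
    ring
  let f : (BV n ⊕ BV n → ℝ) → ℝ := fun z =>
    trnc (z (Sum.inl j)) * trnc (z (Sum.inl k)) * trnc (z (Sum.inr i)) -
      z (Sum.inl j) * z (Sum.inl k) * z (Sum.inr i)
  have hf : Measurable f := by fun_prop
  have hfB (X : BV n → ℝ) : ‖f (gaussPair e n X)‖ ≤ B X :=
    abs_trnc_mul_sub_le_cosh he0.le (by linarith) hs4 _ _ _
  have hg := measurable_gaussPair e n
  constructor
  · rw [Gmeas'_eq]
    exact (integrable_map_measure hf.aestronglyMeasurable hg.aemeasurable).2
      (hB.mono' (hf.comp hg).aestronglyMeasurable (.of_forall hfB))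
  · rw [Gmeas'_eq, ← hBval]
    change |∫ z, f z ∂_| ≤ _
    rw [integral_map hg.aemeasurable hf.aestronglyMeasurable]
    exact norm_integral_le_of_norm_le hB (.of_forall hfB)

lemma integrable_monomial_Gmeas' (he0 : 0 < eps C n) (he1 : 4 * eps C n ≤ 1) :
    Integrable (fun z => z (Sum.inl j) * z (Sum.inl k) * z (Sum.inr i)) (Gmeas' C n) := by
  have := (integrable_trnc_monomial_Gmeas' i j k).sub (trnc_monomial_error i j k he0 he1).1
  simpa [Pi.sub_def] using this

end Monomials

lemma integral_phiOff {n : ℕ} {μ : Measure (BV n ⊕ BV n → ℝ)}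
    (h : ∀ i j k : BV n, j ≠ k →
      Integrable (fun z => z (Sum.inl j) * z (Sum.inl k) * z (Sum.inr i)) μ) :
    ∫ z, phiOff n (fun i => z (Sum.inl i)) (fun i => z (Sum.inr i)) ∂μ =
      (∑ i, ∑ j, ∑ k ∈ Finset.univ \ {j}, Had n i j * Had n i k *
        ∫ z, z (Sum.inl j) * z (Sum.inl k) * z (Sum.inr i) ∂μ) / 2 ^ n := by
  have hterm (i j k : BV n) (z : BV n ⊕ BV n → ℝ) :
      Had n i j * Had n i k * z (Sum.inl j) * z (Sum.inl k) * z (Sum.inr i) =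
        Had n i j * Had n i k * (z (Sum.inl j) * z (Sum.inl k) * z (Sum.inr i)) := by ring
  have hI (i j k : BV n) (hk : k ∈ Finset.univ \ {j}) :
      Integrable (fun z => Had n i j * Had n i k *
        (z (Sum.inl j) * z (Sum.inl k) * z (Sum.inr i))) μ :=
    (h i j k (by simpa [eq_comm] using hk)).const_mul _
  simp_rw [phiOff, hterm]
  rw [integral_div, integral_finsetSum _ fun i _ => integrable_finsetSum _ fun j _ =>
    integrable_finsetSum _ fun k hk => hI i j k hk]
  congr 1
  refine Finset.sum_congr rfl fun i _ => ?_
  rw [integral_finsetSum _ fun j _ => integrable_finsetSum _ fun k hk => hI i j k hk]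
  refine Finset.sum_congr rfl fun j _ => ?_
  rw [integral_finsetSum _ fun k hk => hI i j k hk]
  exact Finset.sum_congr rfl fun k _ => integral_const_mul _ _

lemma abs_integral_phiOff_sub_le {n : ℕ} {C : ℝ} (he0 : 0 < eps C n) (he1 : 4 * eps C n ≤ 1) :
    |(∫ z, phiOff n (fun i => z (Sum.inl i)) (fun i => z (Sum.inr i)) ∂(Dmeas C n))
      - ∫ z, phiOff n (fun i => z (Sum.inl i)) (fun i => z (Sum.inr i)) ∂(Gmeas' C n)| ≤
      2 ^ n * (6 * Real.exp (-(1 / (2 * eps C n)))) := by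
  set δ := 6 * Real.exp (-(1 / (2 * eps C n))) with hδ
  have hδ0 : 0 ≤ δ := by positivity
  have hH (i j k : BV n) : |Had n i j * Had n i k| = 1 / 2 ^ n := by
    rw [abs_mul, abs_Had, abs_Had, div_mul_div_comm, Real.mul_self_sqrt (by positivity), one_mul]
  rw [integral_phiOff fun i j k hjk => integrable_monomial_Dmeas C i hjk,
    integral_phiOff fun i j k _ => integrable_monomial_Gmeas' i j k he0 he1, ← sub_div, abs_div,
    abs_of_pos (by positivity : (0 : ℝ) < 2 ^ n), div_le_iff₀ (by positivity)]
  simp only [← Finset.sum_sub_distrib, ← mul_sub]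
  have hterm (i j k : BV n) (hk : k ∈ Finset.univ \ {j}) :
      |Had n i j * Had n i k * ((∫ z, z (Sum.inl j) * z (Sum.inl k) * z (Sum.inr i) ∂Dmeas C n) -
        ∫ z, z (Sum.inl j) * z (Sum.inl k) * z (Sum.inr i) ∂Gmeas' C n)| ≤ 1 / 2 ^ n * δ := by
    have hjk : j ≠ k := by simpa [eq_comm] using hk
    rw [integral_monomial_Dmeas C i hjk, ← integral_sub (integrable_trnc_monomial_Gmeas' i j k)
      (integrable_monomial_Gmeas' i j k he0 he1), abs_mul, hH]
    gcongr
    exact (trnc_monomial_error i j k he0 he1).2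
  calc _ ≤ ∑ _i : BV n, ∑ j : BV n, ∑ _k ∈ Finset.univ \ {j}, 1 / 2 ^ n * δ := by
        refine (Finset.abs_sum_le_sum_abs _ _).trans (Finset.sum_le_sum fun i _ => ?_)
        refine (Finset.abs_sum_le_sum_abs _ _).trans (Finset.sum_le_sum fun j _ => ?_)
        exact (Finset.abs_sum_le_sum_abs _ _).trans (Finset.sum_le_sum fun k hk => hterm i j k hk)
    _ ≤ ∑ _i : BV n, ∑ _j : BV n, ∑ _k : BV n, 1 / 2 ^ n * δ := by
        gcongr
        exact Finset.subset_univ _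
    _ = 2 ^ n * δ * 2 ^ n := by
        simp only [Finset.sum_const, Finset.card_univ, nsmul_eq_mul, card_BV]
        field_simp

/-- There exists a constant `C₀ ≥ 20` such that for every `C ≥ C₀`,
`|E_{(X,Y) ~ D}[φ_{i≠j}(X,Y)] - E_{(X,Y') ~ G'}[φ_{i≠j}(X,Y')]| ≤ 16 N⁻²`. -/
theorem stmt4 :
    ∃ C₀ : ℝ, 20 ≤ C₀ ∧
      ∀ C : ℝ, C₀ ≤ C → ∀ n : ℕ, 1 ≤ n →
        |(∫ z, phiOff n (fun i => z (Sum.inl i)) (fun i => z (Sum.inr i)) ∂(Dmeas C n))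
          - ∫ z, phiOff n (fun i => z (Sum.inl i)) (fun i => z (Sum.inr i)) ∂(Gmeas' C n)|
          ≤ 16 / (2 ^ n : ℝ) ^ 2 := by
  refine ⟨20, le_rfl, fun C hC n hn => ?_⟩
  have hL : 1 / 2 ≤ Real.log (2 ^ n) := by
    rw [Real.log_pow]
    have : (1 : ℝ) ≤ n := by exact_mod_cast hn
    nlinarith [Real.log_two_gt_d9]
  have hCL : 4 ≤ C * Real.log (2 ^ n) := by nlinarith
  have he0 : 0 < eps C n := one_div_pos.2 (by linarith)
  have he1 : 4 * eps C n ≤ 1 := by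
    rw [eps, mul_one_div, div_le_one (by linarith)]
    exact hCL
  refine (abs_integral_phiOff_sub_le he0 he1).trans ?_
  have hexp : Real.exp (-(1 / (2 * eps C n))) ≤ 1 / (2 ^ n : ℝ) ^ 3 := by
    calc Real.exp (-(1 / (2 * eps C n))) = Real.exp (-(C * Real.log (2 ^ n) / 2)) := by
          rw [eps]; congr 2; field_simp
      _ ≤ Real.exp (-(3 * Real.log (2 ^ n))) := by gcongr; nlinarith
      _ = 1 / (2 ^ n : ℝ) ^ 3 := by
          rw [Real.exp_neg, one_div, show (3 : ℝ) = (3 : ℕ) by norm_num, Real.exp_nat_mul,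
            Real.exp_log (by positivity)]
  calc 2 ^ n * (6 * Real.exp (-(1 / (2 * eps C n))))
      ≤ 2 ^ n * (6 * (1 / (2 ^ n : ℝ) ^ 3)) := by gcongr
    _ = 6 / (2 ^ n : ℝ) ^ 2 := by field_simp
    _ ≤ 16 / (2 ^ n : ℝ) ^ 2 := by gcongr; norm_num
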